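/- Let k ≥ 1 be an integer. Then the hamiltonian chromatic number of the broom tree B_{2k+1} = B_{(k+1)(2k+1),2k+1} is hc(B_{2k+1}) = (2k+1)(2k³ + 5k² − 2k − 1) + 2. -/

import Mathlib

open SimpleGraph Finset

namespace HCPaper

variable {V : Type*}

/-- The detour distance `D(u,v)`: the length of a longest `u`–`v` path. -/
noncomputable def detourDist (G : SimpleGraph V) (u v : V) : ℕ :=
  sSup {n | ∃ p : G.Walk u v, p.IsPath ∧ p.length = n}

/-- A hamiltonian coloring: `D(u,v) + |h u - h v| ≥ n - 1` for all distinct `u, v`. -/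
def IsHamiltonianColoring [Fintype V] (G : SimpleGraph V) (h : V → ℕ) : Prop :=
  ∀ u v : V, u ≠ v →
    Fintype.card V - 1 ≤ detourDist G u v + Nat.dist (h u) (h v)

/-- The span of a coloring: the maximum of `|h u - h v|`. -/
noncomputable def spanOf (h : V → ℕ) : ℕ :=
  sSup (Set.range fun p : V × V => Nat.dist (h p.1) (h p.2))

/-- The hamiltonian chromatic number: minimum span over hamiltonian colorings. -/
noncomputable def hc [Fintype V] (G : SimpleGraph V) : ℕ :=
  sInf {s | ∃ h : V → ℕ, IsHamiltonianColoring G h ∧ spanOf h = s}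

/-- The weight of the graph from a vertex `v`. -/
noncomputable def treeWeight [Fintype V] (G : SimpleGraph V) (v : V) : ℕ :=
  ∑ u, G.dist u v

/-- The set of weight centers. -/
def WeightCenters [Fintype V] (G : SimpleGraph V) : Set V :=
  {v | ∀ u, treeWeight G v ≤ treeWeight G u}

/-- The detour level `L(u) = min {d(u,w) : w ∈ W(T)}`. -/
noncomputable def detourLevel [Fintype V] (G : SimpleGraph V) (u : V) : ℕ :=
  sInf {k | ∃ w ∈ WeightCenters G, G.dist u w = k}

/-- The total detour level `L_W(T) = ∑ L(u)`. -/
noncomputable def totalDetourLevel [Fintype V] (G : SimpleGraph V) : ℕ :=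
  ∑ u, detourLevel G u

/-- `ζ(T)` : 0 if one weight center, 1 if two. -/
noncomputable def zeta [Fintype V] (G : SimpleGraph V) : ℕ :=
  if (WeightCenters G).ncard = 2 then 1 else 0

/-- `ζ'(T) = 1 - ζ(T)`. -/
noncomputable def zeta' [Fintype V] (G : SimpleGraph V) : ℕ := 1 - zeta G

/-- `t` is an ancestor of `v` : `t` lies on the path joining the nearest weight center and `v`. -/
def IsAncestor [Fintype V] (G : SimpleGraph V) (t v : V) : Prop :=
  ∃ w ∈ WeightCenters G, G.dist v w = detourLevel G v ∧
    ∃ p : G.Walk w v, p.IsPath ∧ t ∈ p.support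

/-- `φ(u,v)`: maximum detour level of a common ancestor of `u` and `v`. -/
noncomputable def phi [Fintype V] (G : SimpleGraph V) (u v : V) : ℕ :=
  sSup {k | ∃ t, IsAncestor G t u ∧ IsAncestor G t v ∧ detourLevel G t = k}

open Classical in
/-- `δ(u,v)`: 1 if there are two weight centers `w, w'` and the `u`–`v` path contains
the edge `ww'`, 0 otherwise. -/
noncomputable def delta [Fintype V] (G : SimpleGraph V) (u v : V) : ℕ :=
  if ∃ w w', w ≠ w' ∧ WeightCenters G = {w, w'} ∧
      ∃ p : G.Walk u v, p.IsPath ∧ s(w, w') ∈ p.edges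
  then 1 else 0

/-- `u` and `v` lie in different branches: branches at two distinct vertices adjacent to
the same weight center. -/
def InDifferentBranches [Fintype V] (G : SimpleGraph V) (u v : V) : Prop :=
  ∃ w b₁ b₂, w ∈ WeightCenters G ∧ b₁ ≠ b₂ ∧
    b₁ ∉ WeightCenters G ∧ b₂ ∉ WeightCenters G ∧
    G.Adj w b₁ ∧ G.Adj w b₂ ∧ IsAncestor G b₁ u ∧ IsAncestor G b₂ v

/-- `u` and `v` lie in opposite branches: branches at vertices adjacent to different
weight centers. -/
def InOppositeBranches [Fintype V] (G : SimpleGraph V) (u v : V) : Prop :=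
  ∃ w₁ w₂ b₁ b₂, w₁ ∈ WeightCenters G ∧ w₂ ∈ WeightCenters G ∧ w₁ ≠ w₂ ∧
    b₁ ∉ WeightCenters G ∧ b₂ ∉ WeightCenters G ∧
    G.Adj w₁ b₁ ∧ G.Adj w₂ b₂ ∧ IsAncestor G b₁ u ∧ IsAncestor G b₂ v

/-- The eccentricity of a vertex. -/
noncomputable def ecc (G : SimpleGraph V) (v : V) : ℕ :=
  sSup (Set.range fun u => G.dist v u)

/-- The center of a graph: vertices of minimum eccentricity. -/
def graphCenter (G : SimpleGraph V) : Set V :=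
  {v | ∀ u, ecc G v ≤ ecc G u}

/-- The total level with respect to the center `C(T)`. -/
noncomputable def totalLevel [Fintype V] (G : SimpleGraph V) : ℕ :=
  ∑ u, sInf {k | ∃ x ∈ graphCenter G, G.dist u x = k}

/-- `ε(T)` : 0 if the center has one vertex, 1 if two. -/
noncomputable def eps [Fintype V] (G : SimpleGraph V) : ℕ :=
  if (graphCenter G).ncard = 2 then 1 else 0

/-- `ε'(T) = 1 - ε(T)`. -/
noncomputable def eps' [Fintype V] (G : SimpleGraph V) : ℕ := 1 - eps G

/-- The weight-center based lower bound `lb_W(T)`. -/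
noncomputable def lbW [Fintype V] (G : SimpleGraph V) : ℤ :=
  ((Fintype.card V : ℤ) - 1) * ((Fintype.card V : ℤ) - 1 - zeta G) +
    zeta' G - 2 * totalDetourLevel G

/-- The center based lower bound `lb(T)`. -/
noncomputable def lbC [Fintype V] (G : SimpleGraph V) : ℤ :=
  ((Fintype.card V : ℤ) - 1) * ((Fintype.card V : ℤ) - 1 - eps G) +
    eps' G - 2 * totalLevel G

/-- The broom `B_{n,d}`: a path on vertices `0, …, d-1` together with `n - d` pendant
vertices all adjacent to the end vertex `d-1` of the path. -/
def broom (n d : ℕ) : SimpleGraph (Fin n) :=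
  SimpleGraph.fromRel (fun i j =>
    (i.val + 1 = j.val ∧ j.val < d) ∨ (i.val + 1 = d ∧ d ≤ j.val))

/-- The star `K_{1,n-1}`: vertex `0` adjacent to the `n - 1` other vertices. -/
def starGraph (n : ℕ) : SimpleGraph (Fin n) :=
  SimpleGraph.fromRel (fun i _ => i.val = 0)

/-- The caterpillar `C(m,d)`: a spine `v_1, …, v_m` with `d - 2` legs attached to each
inner spine vertex `v_2, …, v_{m-1}` (so each inner spine vertex has degree `d`). -/
def caterpillar (m d : ℕ) : SimpleGraph (Fin m ⊕ Fin (m - 2) × Fin (d - 2)) :=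
  SimpleGraph.fromRel (fun x y =>
    (∃ i j : Fin m, x = Sum.inl i ∧ y = Sum.inl j ∧ i.val + 1 = j.val) ∨
    (∃ i : Fin m, ∃ a : Fin (m - 2), ∃ b : Fin (d - 2),
      x = Sum.inl i ∧ y = Sum.inr (a, b) ∧ i.val = a.val + 1))


/-! ### Detour distance and spans -/

section General

variable {G : SimpleGraph V}

lemma bddAbove_pathLengths [Fintype V] (G : SimpleGraph V) (u v : V) :
    BddAbove {n | ∃ p : G.Walk u v, p.IsPath ∧ p.length = n} :=
  ⟨Fintype.card V, by rintro _ ⟨p, hp, rfl⟩; exact hp.length_lt.le⟩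

lemma length_le_detourDist [Fintype V] {u v : V} (p : G.Walk u v) (hp : p.IsPath) :
    p.length ≤ detourDist G u v :=
  le_csSup (bddAbove_pathLengths G u v) ⟨p, hp, rfl⟩

lemma detourDist_comm (G : SimpleGraph V) (u v : V) : detourDist G u v = detourDist G v u := by
  unfold detourDist
  congr 1
  ext n
  constructor <;> rintro ⟨p, hp, rfl⟩ <;> exact ⟨p.reverse, hp.reverse, by simp⟩

lemma le_detourDist_of_walk_length [Fintype V] {u v : V} {m : ℕ} (hr : G.Reachable u v)
    (h : ∀ p : G.Walk u v, m ≤ p.length) : m ≤ detourDist G u v := by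
  obtain ⟨p, hp⟩ := hr.exists_isPath
  exact (h p).trans (length_le_detourDist p hp)

lemma dist_le_spanOf [Finite V] (h : V → ℕ) (u v : V) : Nat.dist (h u) (h v) ≤ spanOf h :=
  le_csSup (Set.finite_range _).bddAbove ⟨(u, v), rfl⟩

lemma spanOf_le [Nonempty V] {h : V → ℕ} {s : ℕ} (hs : ∀ v, h v ≤ s) : spanOf h ≤ s := by
  refine csSup_le (Set.range_nonempty _) ?_
  rintro _ ⟨⟨u, v⟩, rfl⟩
  have := hs u
  have := hs v
  simp only [Nat.dist]
  omega

/-- A path whose first edge leads away from the root keeps going away from the root. -/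
lemma level_eq_of_path_down {L : V → ℕ}
    (hL : ∀ u v, G.Adj u v → L v = L u + 1 ∨ L u = L v + 1)
    (hparent : ∀ x u v, G.Adj x u → G.Adj x v → L x = L u + 1 → L x = L v + 1 → u = v)
    {x v : V} (p : G.Walk x v) :
    ∀ u, G.Adj u x → L x = L u + 1 → p.IsPath → u ∉ p.support → L v = L x + p.length := by
  induction p with
  | nil => simp
  | @cons a b c hab q ih =>
    intro u hua hlev hp hu
    rw [Walk.cons_isPath_iff] at hp
    simp only [Walk.support_cons, List.mem_cons, not_or] at hu
    have hb : L b = L a + 1 := by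
      rcases hL a b hab with h | h
      · exact h
      · have := hparent a u b hua.symm hab hlev h
        subst this
        exact absurd q.start_mem_support hu.2
    have := ih a hab hb hp.1 hp.2
    rw [this, Walk.length_cons]
    omega

lemma path_length_le_level_add_level {L : V → ℕ}
    (hL : ∀ u v, G.Adj u v → L v = L u + 1 ∨ L u = L v + 1)
    (hparent : ∀ x u v, G.Adj x u → G.Adj x v → L x = L u + 1 → L x = L v + 1 → u = v)
    {u v : V} (p : G.Walk u v) (hp : p.IsPath) : p.length ≤ L u + L v := by
  induction p with
  | nil => simp
  | @cons a b c hab q ih =>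
    rw [Walk.cons_isPath_iff] at hp
    have hq := ih hp.1
    rw [Walk.length_cons]
    rcases hL a b hab with h | h
    · have := level_eq_of_path_down hL hparent q a hab h hp.1 hp.2
      omega
    · omega

lemma detourDist_le_level_add_level {L : V → ℕ}
    (hL : ∀ u v, G.Adj u v → L v = L u + 1 ∨ L u = L v + 1)
    (hparent : ∀ x u v, G.Adj x u → G.Adj x v → L x = L u + 1 → L x = L v + 1 → u = v)
    (u v : V) : detourDist G u v ≤ L u + L v := by
  refine csSup_le' ?_
  rintro _ ⟨p, hp, rfl⟩
  exact path_length_le_level_add_level hL hparent p hp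

lemma level_le_add_length {L : V → ℕ}
    (hL : ∀ u v, G.Adj u v → L v = L u + 1 ∨ L u = L v + 1)
    {u v : V} (p : G.Walk u v) : L u ≤ L v + p.length := by
  induction p with
  | nil => simp
  | @cons a b c hab q ih =>
    rw [Walk.length_cons]
    rcases hL a b hab with h | h <;> omega

end General

/-- The lower bound on the span obtained by listing the vertices by increasing colour. -/
lemma sq_add_one_le_spanOf_add {N : ℕ} (hN : 1 ≤ N) {G : SimpleGraph (Fin (N + 1))}
    {L : Fin (N + 1) → ℕ} (hdet : ∀ u v, detourDist G u v ≤ L u + L v)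
    (hpos : ∀ u v, u ≠ v → 1 ≤ L u + L v) {h : Fin (N + 1) → ℕ}
    (hh : IsHamiltonianColoring G h) : N * N + 1 ≤ spanOf h + 2 * ∑ v, L v := by
  set σ := Tuple.sort h
  have hmono : Monotone (h ∘ σ) := Tuple.monotone_sort h
  have hstep (i : Fin N) :
      N + h (σ i.castSucc) ≤ L (σ i.castSucc) + L (σ i.succ) + h (σ i.succ) := by
    have hne : σ i.castSucc ≠ σ i.succ := fun e =>
      (Fin.castSucc_lt_succ (i := i)).ne (σ.injective e)
    have h1 := hh _ _ hne
    have h2 := hdet (σ i.castSucc) (σ i.succ)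
    have h3 : h (σ i.castSucc) ≤ h (σ i.succ) := hmono (Fin.castSucc_lt_succ (i := i)).le
    rw [Fintype.card_fin, Nat.dist_eq_sub_of_le h3] at h1
    omega
  have hsum := Finset.sum_le_sum fun i (_ : i ∈ (univ : Finset (Fin N))) => hstep i
  simp only [Finset.sum_add_distrib, Finset.sum_const, Finset.card_univ, Fintype.card_fin,
    smul_eq_mul] at hsum
  have e1 := Fin.sum_univ_castSucc fun i => L (σ i)
  have e2 := Fin.sum_univ_succ fun i => L (σ i)
  have e3 := Fin.sum_univ_castSucc fun i => h (σ i)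
  have e4 := Fin.sum_univ_succ fun i => h (σ i)
  have e5 : ∑ i, L (σ i) = ∑ v, L v := Equiv.sum_comp σ L
  have hends : σ 0 ≠ σ (Fin.last N) := fun e => by
    have := congrArg Fin.val (σ.injective e)
    simp at this
    omega
  have h1 := hpos _ _ hends
  have h2 := dist_le_spanOf h (σ 0) (σ (Fin.last N))
  have h3 : h (σ 0) ≤ h (σ (Fin.last N)) := hmono (Fin.zero_le _)
  rw [Nat.dist_eq_sub_of_le h3] at h2
  omega

/-! ### Levels in a broom -/

/-- The level of the vertex `v` in a broom whose path is `0, …, m`, rooted at `m`. -/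
def broomLevel (m v : ℕ) : ℕ := if v ≤ m then m - v else 1

lemma broom_adj_iff {n m : ℕ} (u v : Fin n) : (broom n (m + 1)).Adj u v ↔
    (u.val + 1 = v.val ∧ v.val ≤ m) ∨ (v.val + 1 = u.val ∧ u.val ≤ m) ∨
      (u.val = m ∧ m < v.val) ∨ (v.val = m ∧ m < u.val) := by
  rw [broom, SimpleGraph.fromRel_adj, ne_eq, Fin.ext_iff]
  omega

lemma broomLevel_of_adj {n m : ℕ} (u v : Fin n) (h : (broom n (m + 1)).Adj u v) :
    broomLevel m v = broomLevel m u + 1 ∨ broomLevel m u = broomLevel m v + 1 := by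
  rw [broom_adj_iff] at h
  unfold broomLevel
  split_ifs <;> omega

lemma broom_parent_unique {n m : ℕ} (x u v : Fin n) (hu : (broom n (m + 1)).Adj x u)
    (hv : (broom n (m + 1)).Adj x v) (hxu : broomLevel m x = broomLevel m u + 1)
    (hxv : broomLevel m x = broomLevel m v + 1) : u = v := by
  rw [broom_adj_iff] at hu hv
  unfold broomLevel at hxu hxv
  rw [Fin.ext_iff]
  split_ifs at hxu hxv <;> omega

lemma broom_connected {n m : ℕ} (hm : m < n) : (broom n (m + 1)).Connected := by
  have key : ∀ l, ∀ u : Fin n, broomLevel m u = l → (broom n (m + 1)).Reachable u ⟨m, hm⟩ := by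
    intro l
    induction l with
    | zero =>
      intro u hu
      have : u = ⟨m, hm⟩ := by
        unfold broomLevel at hu
        rw [Fin.ext_iff]
        split_ifs at hu
        simp only
        omega
      rw [this]
    | succ l ih =>
      intro u hu
      unfold broomLevel at hu
      split_ifs at hu with hum
      · have hlt : u.val + 1 < n := by omega
        refine (SimpleGraph.Adj.reachable ?_).trans (ih ⟨u.val + 1, hlt⟩ ?_)
        · rw [broom_adj_iff]
          exact Or.inl ⟨rfl, show u.val + 1 ≤ m by omega⟩
        · unfold broomLevel
          simp only
          split_ifs <;> omega
      · refine SimpleGraph.Adj.reachable ?_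
        rw [broom_adj_iff]
        exact Or.inr (Or.inr (Or.inr ⟨rfl, not_le.mp hum⟩))
  have : Nonempty (Fin n) := ⟨⟨m, hm⟩⟩
  exact ⟨fun u v => (key _ u rfl).trans (key _ v rfl).symm⟩

lemma broom_sub_le_detourDist {n m : ℕ} (hm : m < n) (u v : Fin n) :
    broomLevel m u - broomLevel m v ≤ detourDist (broom n (m + 1)) u v := by
  refine le_detourDist_of_walk_length ((broom_connected hm).preconnected u v) fun p => ?_
  have := level_le_add_length (L := fun x : Fin n => broomLevel m x) broomLevel_of_adj p
  omega

lemma broom_level_succ_le_detourDist {n m : ℕ} (hm : m < n) {u v : Fin n} (huv : u ≠ v)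
    (hv : m < v.val) : broomLevel m u + 1 ≤ detourDist (broom n (m + 1)) u v := by
  rw [detourDist_comm]
  refine le_detourDist_of_walk_length ((broom_connected hm).preconnected v u) fun p => ?_
  cases p with
  | nil => exact absurd rfl huv
  | @cons _ b _ h q =>
    have hq := level_le_add_length (L := fun x : Fin n => broomLevel m x) broomLevel_of_adj
      q.reverse
    rw [broom_adj_iff] at h
    have hb : broomLevel m b = 0 := by
      unfold broomLevel
      split_ifs <;> omega
    simp only [Walk.length_reverse, hb] at hq
    rw [Walk.length_cons]
    omega

lemma sum_range_broomLevel (m l : ℕ) :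
    2 * ∑ v ∈ range (m + 1 + l), broomLevel m v = m * (m + 1) + 2 * l := by
  rw [Finset.sum_range_add]
  have h1 : ∑ v ∈ range (m + 1), broomLevel m v = ∑ v ∈ range (m + 1), v := by
    rw [← Finset.sum_range_reflect]
    refine Finset.sum_congr rfl fun v hv => ?_
    rw [Finset.mem_range] at hv
    unfold broomLevel
    split_ifs <;> omega
  have h2 : ∑ v ∈ range l, broomLevel m (m + 1 + v) = l := by
    rw [Finset.sum_congr rfl (g := fun _ => 1)]
    · simp
    · intro v _
      unfold broomLevel
      split_ifs <;> omega
  have h3 := Finset.sum_range_id_mul_two (m + 1)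
  rw [h1, h2]
  rw [Nat.add_sub_cancel] at h3
  linarith

/-! ### An optimal coloring -/

/-- The colour of the `i`-th leaf: the first `2 * k + 1` leaves alternate with the vertices of the
path, the remaining leaves follow each other. -/
def leafColor (k i : ℕ) : ℤ :=
  if i ≤ 2 * k then 2 * k ^ 2 + 3 * k - 1 + 2 * i * (2 * k ^ 2 + k - 1) + i * (i - 1)
  else 2 * k ^ 2 + 3 * k - 1 + 4 * k * (2 * k ^ 2 + k - 1) + 2 * k * (2 * k - 1)
    + (i - 2 * k) * (2 * k ^ 2 + 3 * k - 2)

/-- The colour of the `i`-th vertex of the path. -/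
def pathColor (k i : ℕ) : ℤ :=
  2 * k ^ 2 + 3 * k - 1 + (2 * i + 1) * (2 * k ^ 2 + k - 1) + i ^ 2

/-- The colours of an optimal hamiltonian coloring of the broom `B_{2k+1}`. -/
def broomColor (k v : ℕ) : ℤ :=
  if v < 2 * k then pathColor k v else if v = 2 * k then 0 else leafColor k (v - (2 * k + 1))

lemma pathColor_gap {k i j : ℕ} (hk : 1 ≤ k) (hij : i < j) :
    2 * (k : ℤ) ^ 2 + 3 * k ≤ (j - i) + (pathColor k j - pathColor k i) := by
  unfold pathColor
  obtain ⟨a, rfl⟩ := Nat.exists_eq_add_of_lt hij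
  obtain ⟨b, rfl⟩ := Nat.exists_eq_add_of_le' hk
  push_cast
  ring_nf
  have : 0 ≤ (a : ℤ) := by positivity
  have : 0 ≤ (b : ℤ) := by positivity
  have : 0 ≤ (i : ℤ) := by positivity
  nlinarith [mul_nonneg ‹0 ≤ (a : ℤ)› ‹0 ≤ (b : ℤ)›,
    mul_nonneg ‹0 ≤ (a : ℤ)› ‹0 ≤ (i : ℤ)›, sq_nonneg (b : ℤ),
    mul_nonneg ‹0 ≤ (a : ℤ)› (sq_nonneg (b : ℤ))]

lemma leafColor_add_le_succ {k : ℕ} (hk : 1 ≤ k) (i : ℕ) :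
    leafColor k i + (2 * (k : ℤ) ^ 2 + 3 * k - 2) ≤ leafColor k (i + 1) := by
  have hk' : (1 : ℤ) ≤ k := by exact_mod_cast hk
  unfold leafColor
  rcases lt_trichotomy i (2 * k) with h | h | h
  · rw [if_pos h.le, if_pos (by omega)]
    push_cast
    nlinarith
  · subst h
    rw [if_pos le_rfl, if_neg (by omega)]
    push_cast
    nlinarith
  · rw [if_neg (by omega), if_neg (by omega)]
    push_cast
    nlinarith

lemma leafColor_mono {k : ℕ} (hk : 1 ≤ k) : Monotone (leafColor k) := by
  refine monotone_nat_of_le_succ fun i => ?_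
  have hk' : (1 : ℤ) ≤ k := by exact_mod_cast hk
  have := leafColor_add_le_succ hk i
  nlinarith

lemma leafColor_gap {k i j : ℕ} (hk : 1 ≤ k) (hij : i < j) :
    2 * (k : ℤ) ^ 2 + 3 * k ≤ 2 + (leafColor k j - leafColor k i) := by
  have := leafColor_mono hk (Nat.succ_le_of_lt hij)
  have := leafColor_add_le_succ hk i
  simp only [Nat.succ_eq_add_one] at *
  linarith

lemma leafColor_zero (k : ℕ) : leafColor k 0 = 2 * (k : ℤ) ^ 2 + 3 * k - 1 := by
  simp [leafColor]

lemma le_leafColor {k : ℕ} (hk : 1 ≤ k) (i : ℕ) :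
    2 * (k : ℤ) ^ 2 + 3 * k - 1 ≤ leafColor k i :=
  (leafColor_zero k).ge.trans (leafColor_mono hk (Nat.zero_le i))

lemma le_pathColor {k : ℕ} (hk : 1 ≤ k) (i : ℕ) : 2 * (k : ℤ) ^ 2 + 3 * k ≤ pathColor k i := by
  have hk' : (1 : ℤ) ≤ k := by exact_mod_cast hk
  have hi : (0 : ℤ) ≤ i := by positivity
  unfold pathColor
  nlinarith [mul_nonneg hi (by nlinarith : (0 : ℤ) ≤ 2 * k ^ 2 + k - 1)]

lemma pathColor_sub_leafColor {k v i : ℕ} (hk : 1 ≤ k) (hv : v < 2 * k) (hi : i ≤ v) :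
    2 * (k : ℤ) ^ 2 + 3 * k ≤ (2 * k - v + 1) + (pathColor k v - leafColor k i) := by
  have hk' : (1 : ℤ) ≤ k := by exact_mod_cast hk
  have hc : (0 : ℤ) ≤ 2 * k ^ 2 + k - 1 := by nlinarith
  unfold pathColor leafColor
  rw [if_pos (by omega)]
  obtain ⟨a, rfl⟩ := Nat.exists_eq_add_of_le hi
  have hi : (0 : ℤ) ≤ i := by positivity
  have ha : (0 : ℤ) ≤ a := by positivity
  have haa : (a : ℤ) ≤ a * a := by exact_mod_cast Nat.le_mul_self a
  push_cast
  nlinarith [mul_nonneg ha hc, mul_nonneg ha hi]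

lemma leafColor_sub_pathColor {k v i : ℕ} (hk : 1 ≤ k) (hv : v < 2 * k) (hi : v < i) :
    2 * (k : ℤ) ^ 2 + 3 * k ≤ (2 * k - v + 1) + (leafColor k i - pathColor k v) := by
  have hk' : (1 : ℤ) ≤ k := by exact_mod_cast hk
  have hmono := leafColor_mono hk (Nat.succ_le_of_lt hi)
  have hsucc : leafColor k (v + 1) = 2 * k ^ 2 + 3 * k - 1
      + 2 * (v + 1) * (2 * k ^ 2 + k - 1) + (v + 1) * v := by
    unfold leafColor
    rw [if_pos (by omega)]
    push_cast
    ring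
  rw [Nat.succ_eq_add_one, hsucc] at hmono
  unfold pathColor
  nlinarith

lemma leafColor_last {k : ℕ} (hk : 1 ≤ k) : leafColor k (k * (2 * k + 1) - 1) =
    (2 * (k : ℤ) + 1) * (2 * (k : ℤ) ^ 3 + 5 * (k : ℤ) ^ 2 - 2 * (k : ℤ) - 1) + 2 := by
  have hpos : 1 ≤ k * (2 * k + 1) := by nlinarith
  unfold leafColor
  split_ifs with h
  · have : k = 1 := by
      by_contra hne
      have : 2 ≤ k := by omega
      have : k * (2 * k + 1) ≤ 2 * k + 1 := by omega
      nlinarith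
    subst this
    norm_num
  · push_cast [Nat.cast_sub hpos]
    ring

lemma broomColor_nonneg {k : ℕ} (hk : 1 ≤ k) (v : ℕ) : 0 ≤ broomColor k v := by
  have hk' : (1 : ℤ) ≤ k := by exact_mod_cast hk
  unfold broomColor
  split_ifs
  · have := le_pathColor hk v
    nlinarith
  · rfl
  · have := le_leafColor hk (v - (2 * k + 1))
    nlinarith

lemma broomColor_le {k v : ℕ} (hk : 1 ≤ k) (hv : v < (k + 1) * (2 * k + 1)) :
    broomColor k v ≤ leafColor k (k * (2 * k + 1) - 1) := by
  have hk' : (1 : ℤ) ≤ k := by exact_mod_cast hk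
  have hlast : 2 * k ≤ k * (2 * k + 1) - 1 := by
    have : 2 * k + 1 ≤ k * (2 * k + 1) := by nlinarith
    omega
  unfold broomColor
  split_ifs with h1 h2
  · have h := leafColor_sub_pathColor hk h1 h1
    have := leafColor_mono hk hlast
    have : (0 : ℤ) ≤ v := by positivity
    nlinarith
  · have := le_leafColor hk (k * (2 * k + 1) - 1)
    nlinarith
  · refine leafColor_mono hk ?_
    rw [add_mul, one_mul] at hv
    omega

lemma le_detourDist_add_dist_broomColor {k : ℕ} (hk : 1 ≤ k) {n : ℕ} (hn : 2 * k < n)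
    {u v : Fin n} (huv : u < v) :
    2 * (k : ℤ) ^ 2 + 3 * k ≤ (detourDist (broom n (2 * k + 1)) u v : ℤ) +
      |broomColor k u - broomColor k v| := by
  have hk' : (1 : ℤ) ≤ k := by exact_mod_cast hk
  have hne : u ≠ v := huv.ne
  rw [Fin.lt_def] at huv
  have habs := le_abs_self (broomColor k u - broomColor k v)
  have habs' := neg_abs_le (broomColor k u - broomColor k v)
  by_cases hv : v.val ≤ 2 * k
  · have hu : u.val < 2 * k := by omega
    have hd := broom_sub_le_detourDist hn u v
    simp only [broomLevel, hu.le, hv, if_true] at hd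
    have hd' : (v.val : ℤ) - u.val ≤ detourDist (broom n (2 * k + 1)) u v := by omega
    rcases hv.lt_or_eq with hv' | hv'
    · have := pathColor_gap hk huv
      simp only [broomColor, hu, hv', if_true] at habs habs' ⊢
      linarith
    · have := le_pathColor hk u
      simp only [broomColor, hu, hv', if_true, lt_irrefl, if_false] at habs habs' ⊢
      linarith
  · have hd := broom_level_succ_le_detourDist hn hne (not_le.mp hv)
    have hv1 : ¬ v.val < 2 * k := by omega
    have hv2 : ¬ v.val = 2 * k := by omega
    rcases lt_trichotomy u.val (2 * k) with hu | hu | hu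
    · simp only [broomLevel, hu.le, if_true] at hd
      have hd' : 2 * (k : ℤ) - u.val + 1 ≤ detourDist (broom n (2 * k + 1)) u v := by omega
      simp only [broomColor, hu, hv1, hv2, if_true, if_false] at habs habs' ⊢
      rcases le_or_gt (v.val - (2 * k + 1)) u.val with h | h
      · have := pathColor_sub_leafColor hk hu h
        linarith
      · have := leafColor_sub_pathColor hk hu h
        linarith
    · have := le_leafColor hk (v.val - (2 * k + 1))
      simp only [broomColor, hu, hv1, hv2, if_true, if_false, lt_irrefl] at habs habs' ⊢
      have : (1 : ℤ) ≤ detourDist (broom n (2 * k + 1)) u v := by omega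
      linarith
    · have hu1 : ¬ u.val < 2 * k := by omega
      have hu2 : ¬ u.val = 2 * k := by omega
      have := leafColor_gap hk (show u.val - (2 * k + 1) < v.val - (2 * k + 1) by omega)
      simp only [broomLevel, not_le.mpr hu, if_false] at hd
      simp only [broomColor, hu1, hu2, hv1, hv2, if_false] at habs habs' ⊢
      have : (2 : ℤ) ≤ detourDist (broom n (2 * k + 1)) u v := by omega
      linarith

lemma isHamiltonianColoring_broomColor {k : ℕ} (hk : 1 ≤ k) :
    IsHamiltonianColoring (broom ((k + 1) * (2 * k + 1)) (2 * k + 1))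
      fun v => (broomColor k v).toNat := by
  have hn : 2 * k < (k + 1) * (2 * k + 1) := by nlinarith
  have hcard : ((k + 1) * (2 * k + 1) - 1 : ℕ) = 2 * k ^ 2 + 3 * k := by
    rw [show (k + 1) * (2 * k + 1) = 2 * k ^ 2 + 3 * k + 1 by ring, Nat.add_sub_cancel]
  have hdist (a b : ℕ) : ((Nat.dist (broomColor k a).toNat (broomColor k b).toNat : ℕ) : ℤ) =
      |broomColor k a - broomColor k b| := by
    have := broomColor_nonneg hk a
    have := broomColor_nonneg hk b
    rw [Nat.dist, abs_eq_max_neg]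
    omega
  intro u v huv
  rw [Fintype.card_fin, hcard]
  zify
  rw [hdist]
  rcases lt_or_gt_of_ne huv with h | h
  · exact le_detourDist_add_dist_broomColor hk hn h
  · rw [detourDist_comm, abs_sub_comm]
    exact le_detourDist_add_dist_broomColor hk hn h

lemma le_spanOf_of_isHamiltonianColoring_broom {k n : ℕ} (hk : 1 ≤ k)
    (hn : n = (k + 1) * (2 * k + 1)) {h : Fin n → ℕ}
    (hh : IsHamiltonianColoring (broom n (2 * k + 1)) h) :
    (2 * (k : ℤ) + 1) * (2 * (k : ℤ) ^ 3 + 5 * (k : ℤ) ^ 2 - 2 * (k : ℤ) - 1) + 2 ≤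
      spanOf h := by
  obtain rfl : n = 2 * k ^ 2 + 3 * k + 1 := by rw [hn]; ring
  have hpos (u v : Fin (2 * k ^ 2 + 3 * k + 1)) (huv : u ≠ v) :
      1 ≤ broomLevel (2 * k) u + broomLevel (2 * k) v := by
    rw [ne_eq, Fin.ext_iff] at huv
    unfold broomLevel
    split_ifs <;> omega
  have hlow := sq_add_one_le_spanOf_add (by nlinarith)
    (L := fun v => broomLevel (2 * k) v)
    (detourDist_le_level_add_level broomLevel_of_adj broom_parent_unique) hpos hh
  have hsum := sum_range_broomLevel (2 * k) (2 * k ^ 2 + k)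
  rw [show 2 * k + 1 + (2 * k ^ 2 + k) = 2 * k ^ 2 + 3 * k + 1 by ring,
    ← Fin.sum_univ_eq_sum_range] at hsum
  rw [hsum] at hlow
  zify at hlow
  linarith

/-- `hc(B_{2k+1}) = (2k+1)(2k³ + 5k² - 2k - 1) + 2`. -/
theorem stmt10 (k : ℕ) (hk : 1 ≤ k) :
    (hc (broom ((k + 1) * (2 * k + 1)) (2 * k + 1)) : ℤ) =
      (2 * (k : ℤ) + 1) * (2 * (k : ℤ) ^ 3 + 5 * (k : ℤ) ^ 2 - 2 * (k : ℤ) - 1) + 2 := by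
  have hn : 0 < (k + 1) * (2 * k + 1) := by positivity
  have : Nonempty (Fin ((k + 1) * (2 * k + 1))) := ⟨⟨0, hn⟩⟩
  have hcol := isHamiltonianColoring_broomColor hk
  apply le_antisymm
  · rw [← leafColor_last hk]
    have hle : hc (broom ((k + 1) * (2 * k + 1)) (2 * k + 1)) ≤
        (leafColor k (k * (2 * k + 1) - 1)).toNat :=
      le_trans (Nat.sInf_le ⟨_, hcol, rfl⟩)
        (spanOf_le fun v => Int.toNat_le_toNat (broomColor_le hk v.isLt))
    have hnonneg : 0 ≤ leafColor k (k * (2 * k + 1) - 1) :=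
      (broomColor_nonneg hk 0).trans (broomColor_le hk hn)
    omega
  · obtain ⟨h, hh, hs⟩ := Nat.sInf_mem
      (s := {s | ∃ h, IsHamiltonianColoring (broom ((k + 1) * (2 * k + 1)) (2 * k + 1)) h ∧
        spanOf h = s}) ⟨_, _, hcol, rfl⟩
    rw [hc, ← hs]
    exact le_spanOf_of_isHamiltonianColoring_broom hk rfl hh

end HCPaper
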